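/- arXiv:0906.4196 — 5 statements merged into one kernel-verified Lean document; each statement's English description precedes it below -/
import Mathlib

section
/- Let X and Y be compact Hausdorff spaces with Y non-empty, and let Φ : C(X) → C(Y) be a linear map such that Φf is non-vanishing on Y if and only if f is non-vanishing on X. Then Φ(1_X) is non-vanishing, and for every f ∈ C(X), the range of the function y ↦ (Φf)(y)/(Φ1_X)(y) on Y equals the range of f on X. -/
open Function Set

variable {X Y : Type*}
  [TopologicalSpace X] [CompactSpace X] [T2Space X]
  [TopologicalSpace Y] [CompactSpace Y] [T2Space Y]

/-- Φ1 is non-vanishing and the range of (Φf)/(Φ1) equals the range of f. -/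
theorem stmt_13 [Nonempty Y] (Φ : C(X, ℝ) → C(Y, ℝ))
    (hlin : IsLinearMap ℝ Φ)
    (hnv : ∀ f : C(X, ℝ), (∀ x, f x ≠ 0) ↔ (∀ y, Φ f y ≠ 0)) :
    (∀ y : Y, Φ 1 y ≠ 0) ∧
    ∀ f : C(X, ℝ), (Set.range fun y : Y => Φ f y / Φ 1 y) = Set.range f := by
  have h1 : ∀ y : Y, Φ 1 y ≠ 0 := (hnv 1).1 fun _ => one_ne_zero
  refine ⟨h1, fun f => Set.ext fun c => ?_⟩
  have hc : Φ (f - c • 1) = Φ f - c • Φ 1 := by rw [hlin.map_sub, hlin.map_smul]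
  have key := not_congr (hnv (f - c • 1))
  rw [hc] at key
  push Not at key
  simp only [ContinuousMap.sub_apply, ContinuousMap.smul_apply, ContinuousMap.one_apply,
    smul_eq_mul, mul_one, sub_eq_zero] at key
  simp only [Set.mem_range, div_eq_iff (h1 _)]
  exact key.symm
end

section
/- Let X and Y be non-empty compact Hausdorff spaces, and let Φ : C(X) → C(Y) be a linear map such that Φf is non-vanishing on Y if and only if f is non-vanishing on X. Then the map f ↦ (Φf)/(Φ1_X) (pointwise quotient, which is well defined since Φ1_X is non-vanishing) is a unital linear isometry from C(X) into C(Y): it sends 1_X to 1_Y and preserves the sup norm. -/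
open Function Set

/-- The sup norm is monotone under inclusion of ranges. -/
lemma ContinuousMap.norm_le_norm_of_range_subset {X Y : Type*}
    [TopologicalSpace X] [CompactSpace X] [TopologicalSpace Y] [CompactSpace Y]
    {f : C(X, ℝ)} {g : C(Y, ℝ)} (h : range f ⊆ range g) : ‖f‖ ≤ ‖g‖ := by
  refine (ContinuousMap.norm_le f (norm_nonneg g)).2 fun x => ?_
  obtain ⟨y, hy⟩ := h (mem_range_self x)
  exact hy ▸ g.norm_coe_le_norm y

variable {X Y : Type*}
  [TopologicalSpace X] [CompactSpace X] [T2Space X]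
  [TopologicalSpace Y] [CompactSpace Y] [T2Space Y]

/-- f ↦ (Φf)/(Φ1) is a unital linear isometry from C(X) into C(Y). -/
theorem stmt_14 [Nonempty X] [Nonempty Y] (Φ : C(X, ℝ) → C(Y, ℝ))
    (hlin : IsLinearMap ℝ Φ)
    (hnv : ∀ f : C(X, ℝ), (∀ x, f x ≠ 0) ↔ (∀ y, Φ f y ≠ 0)) :
    ∃ Ψ : C(X, ℝ) → C(Y, ℝ),
      (∀ (f : C(X, ℝ)) (y : Y), Ψ f y = Φ f y / Φ 1 y) ∧
      IsLinearMap ℝ Ψ ∧ Ψ 1 = 1 ∧ ∀ f : C(X, ℝ), ‖Ψ f‖ = ‖f‖ := by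
  have h1 : ∀ y, Φ 1 y ≠ 0 := (hnv 1).1 fun _ => one_ne_zero
  let Ψ : C(X, ℝ) → C(Y, ℝ) := fun f =>
    ⟨fun y => Φ f y / Φ 1 y, (Φ f).continuous.div (Φ 1).continuous h1⟩
  have hΨ : ∀ f y, Ψ f y = Φ f y / Φ 1 y := fun _ _ => rfl
  have hrange : ∀ f, range (Ψ f) = range f := by
    intro f
    ext c
    have hc := not_congr (hnv (f - c • 1))
    rw [hlin.map_sub, hlin.map_smul] at hc
    push Not at hc
    simp only [ContinuousMap.sub_apply, ContinuousMap.smul_apply, ContinuousMap.one_apply,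
      smul_eq_mul, mul_one, sub_eq_zero] at hc
    simp only [mem_range, hΨ, div_eq_iff (h1 _)]
    exact hc.symm
  refine ⟨Ψ, hΨ, ⟨fun f g => ?_, fun c f => ?_⟩, ?_, fun f => le_antisymm
    (ContinuousMap.norm_le_norm_of_range_subset (hrange f).subset)
    (ContinuousMap.norm_le_norm_of_range_subset (hrange f).symm.subset)⟩
  · ext y
    simp [hΨ, hlin.map_add, add_div]
  · ext y
    simp [hΨ, hlin.map_smul, mul_div_assoc]
  · ext y
    simp [hΨ, h1 y]
end

section
/- Let X and Y be non-empty compact Hausdorff spaces, and let Φ : C(X) → C(Y) be a surjective linear map such that Φf is non-vanishing on Y if and only if f is non-vanishing on X. Then X is homeomorphic to Y. -/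
open Function Set

/-- A range-preserving linear bijection between spaces of continuous functions is an order
isomorphism, hence commutes with absolute values. -/
theorem map_abs_of_range_eq {X Y : Type*} [TopologicalSpace X] [TopologicalSpace Y]
    (T : C(X, ℝ) ≃ₗ[ℝ] C(Y, ℝ)) (hT : ∀ f, range (T f) = range f) (f : C(X, ℝ)) :
    T |f| = |T f| := by
  have hnonneg (g : C(X, ℝ)) : 0 ≤ T g ↔ 0 ≤ g := by
    simp only [ContinuousMap.le_def, ContinuousMap.zero_apply]
    rw [← forall_mem_range (f := T g) (p := fun r => 0 ≤ r), hT, forall_mem_range]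
  let e : C(X, ℝ) ≃o C(Y, ℝ) :=
    { T.toEquiv with
      map_rel_iff' := by
        intro a b
        change T a ≤ T b ↔ a ≤ b
        rw [← sub_nonneg, ← map_sub, hnonneg, sub_nonneg] }
  have h : T (f ⊔ -f) = T f ⊔ T (-f) := e.map_sup f (-f)
  rw [abs, abs, h, map_neg]

/-- A function into a compact Hausdorff space is continuous if its composition with every
continuous real-valued function is. -/
theorem continuous_of_forall_continuous_comp {X Y : Type*} [TopologicalSpace X] [CompactSpace X]
    [T2Space X] [TopologicalSpace Y] (σ : Y → X) (h : ∀ f : C(X, ℝ), Continuous (f ∘ σ)) :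
    Continuous σ := by
  rw [continuous_iff_continuousAt]
  intro y U hU
  obtain ⟨V, hVU, hV, hyV⟩ := mem_nhds_iff.mp hU
  obtain ⟨f, hf0, hf1, -⟩ := exists_continuous_zero_one_of_isClosed (isClosed_singleton (x := σ y))
    hV.isClosed_compl (by simpa using hyV)
  have hlt : f (σ y) < 1 := by
    rw [hf0 rfl]
    exact one_pos
  filter_upwards [(h f).continuousAt.eventually_lt_const hlt] with z hz
  by_contra hzU
  exact hz.ne (hf1 fun hzV => hzU (hVU hzV))

/-- A range-preserving linear bijection is composition with a continuous map. -/
theorem exists_continuous_comp_of_range_eq {X Y : Type*} [TopologicalSpace X] [CompactSpace X]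
    [T2Space X] [TopologicalSpace Y]
    (T : C(X, ℝ) ≃ₗ[ℝ] C(Y, ℝ)) (hT : ∀ f, range (T f) = range f) :
    ∃ σ : Y → X, Continuous σ ∧ ∀ f y, T f y = f (σ y) := by
  have hone : T 1 = 1 := by
    ext y
    obtain ⟨x, hx⟩ : T 1 y ∈ range (1 : C(X, ℝ)) := hT 1 ▸ mem_range_self y
    exact hx.symm
  have hpoint (y : Y) : ∃ x, ∀ f, T f y = f x := by
    by_contra! hne
    choose f hf using hne
    let g (x : X) : C(X, ℝ) := |f x - (T (f x) y) • 1|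
    have hTg (x : X) : T (g x) y = 0 := by
      simp [g, map_abs_of_range_eq T hT, hone]
    have hgx (x : X) : 0 < g x x := by
      simpa [g, sub_eq_zero] using (hf x).symm
    obtain ⟨t, ht⟩ := CompactSpace.elim_nhds_subcover (fun x => {z | 0 < g x z})
      fun x => (g x).continuous.continuousAt.eventually_const_lt (hgx x)
    obtain ⟨z, hz⟩ : (0 : ℝ) ∈ range (∑ x ∈ t, g x : C(X, ℝ)) := by
      rw [← hT]
      exact ⟨y, by simp [map_sum, hTg]⟩
    have hzt : z ∈ ⋃ x ∈ t, {z | 0 < g x z} := ht ▸ mem_univ z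
    simp only [mem_iUnion, mem_ofPred_eq] at hzt
    obtain ⟨x, hxt, hx⟩ := hzt
    have hpos : 0 < ∑ x ∈ t, g x z :=
      Finset.sum_pos' (fun x _ => by simp [g]) ⟨x, hxt, hx⟩
    rw [ContinuousMap.sum_apply] at hz
    exact hpos.ne' hz
  choose σ hσ using hpoint
  refine ⟨σ, continuous_of_forall_continuous_comp σ fun f => ?_, fun f y => hσ y f⟩
  convert (T f).continuous using 1
  ext y
  exact (hσ y f).symm

/-- Continuous real-valued functions separate the points of a compact Hausdorff space. -/
theorem eq_of_forall_continuousMap_eq {X : Type*} [TopologicalSpace X] [CompactSpace X]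
    [T2Space X] {a b : X} (h : ∀ f : C(X, ℝ), f a = f b) : a = b := by
  by_contra hab
  obtain ⟨f, hf0, hf1, -⟩ := exists_continuous_zero_one_of_isClosed
    (isClosed_singleton (x := a)) (isClosed_singleton (x := b)) (by simpa using hab)
  have hfa : f a = 0 := hf0 rfl
  have hfb : f b = 1 := hf1 rfl
  simpa [hfa, hfb] using h f

/-- Compact Hausdorff spaces related by a range-preserving linear bijection of their spaces of
continuous functions are homeomorphic. -/
theorem nonempty_homeomorph_of_range_eq {X Y : Type*}
    [TopologicalSpace X] [CompactSpace X] [T2Space X]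
    [TopologicalSpace Y] [CompactSpace Y] [T2Space Y]
    (T : C(X, ℝ) ≃ₗ[ℝ] C(Y, ℝ)) (hT : ∀ f, range (T f) = range f) :
    Nonempty (X ≃ₜ Y) := by
  obtain ⟨σ, hσc, hσ⟩ := exists_continuous_comp_of_range_eq T hT
  obtain ⟨τ, hτc, hτ⟩ := exists_continuous_comp_of_range_eq T.symm fun g => by
    rw [← hT, T.apply_symm_apply]
  exact ⟨{ toFun := τ
           invFun := σ
           left_inv := fun x => eq_of_forall_continuousMap_eq fun f => by
             rw [← hσ, ← hτ, T.symm_apply_apply]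
           right_inv := fun y => eq_of_forall_continuousMap_eq fun g => by
             rw [← hτ, ← hσ, T.apply_symm_apply]
           continuous_toFun := hτc
           continuous_invFun := hσc }⟩

variable {X Y : Type*}
  [TopologicalSpace X] [CompactSpace X] [T2Space X]
  [TopologicalSpace Y] [CompactSpace Y] [T2Space Y]

/-- A surjective linear map preserving non-vanishing in both directions yields
a homeomorphism between X and Y. -/
theorem stmt_15 [Nonempty X] [Nonempty Y] (Φ : C(X, ℝ) → C(Y, ℝ))
    (hlin : IsLinearMap ℝ Φ) (hsurj : Function.Surjective Φ)
    (hnv : ∀ f : C(X, ℝ), (∀ x, f x ≠ 0) ↔ (∀ y, Φ f y ≠ 0)) :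
    Nonempty (X ≃ₜ Y) := by
  have hu : ∀ y, Φ 1 y ≠ 0 := (hnv 1).mp fun _ => one_ne_zero
  let v : C(Y, ℝ) := ⟨fun y => (Φ 1 y)⁻¹, (Φ 1).continuous.inv₀ hu⟩
  let S : C(X, ℝ) →ₗ[ℝ] C(Y, ℝ) := LinearMap.mulLeft ℝ v ∘ₗ hlin.mk' Φ
  have hS (f : C(X, ℝ)) (y : Y) : S f y = (Φ 1 y)⁻¹ * Φ f y := rfl
  have hrange (f : C(X, ℝ)) : range (S f) = range f := by
    ext c
    have hshift (y : Y) : Φ (f - c • 1) y = Φ f y - c * Φ 1 y := by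
      rw [hlin.map_sub, hlin.map_smul]
      rfl
    have hzero (y : Y) : Φ (f - c • 1) y = 0 ↔ S f y = c := by
      rw [hshift, hS, sub_eq_zero, inv_mul_eq_iff_eq_mul₀ (hu y), mul_comm]
    have h := not_congr (hnv (f - c • 1))
    push Not at h
    simp only [hzero] at h
    simpa [sub_eq_zero] using h.symm
  have hinj : Injective S := by
    refine (injective_iff_map_eq_zero S).mpr fun f hf => ?_
    ext x
    obtain ⟨y, hy⟩ : f x ∈ range (S f) := hrange f ▸ mem_range_self x
    rw [← hy, hf]
    rfl
  have hsurjS : Surjective S := fun g => by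
    obtain ⟨f, hf⟩ := hsurj (Φ 1 * g)
    refine ⟨f, ?_⟩
    ext y
    rw [hS, hf, ContinuousMap.mul_apply, inv_mul_cancel_left₀ (hu y)]
  exact nonempty_homeomorph_of_range_eq (.ofBijective S ⟨hinj, hsurjS⟩) hrange
end

section
/- Let X and Y be non-empty compact Hausdorff spaces, and let Φ : C(X) → C(Y) be a surjective linear map such that Φf is non-vanishing on Y if and only if f is non-vanishing on X. If Φ1_X is strictly positive on Y (i.e., (Φ1_X)(y) > 0 for every y ∈ Y), then Φ is a Riesz isomorphism: Φ is bijective and Φ(f ⊔ g) = Φf ⊔ Φg for all f, g ∈ C(X). -/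
open Function Set

/-- A linear map preserving non-vanishing in both directions preserves the range of a function,
up to scaling by the image of `1`. -/
theorem exists_eq_iff_exists_map_eq_mul {X Y : Type*} [TopologicalSpace X] [TopologicalSpace Y]
    (Φ : C(X, ℝ) → C(Y, ℝ)) (hlin : IsLinearMap ℝ Φ)
    (hnv : ∀ f : C(X, ℝ), (∀ x, f x ≠ 0) ↔ (∀ y, Φ f y ≠ 0)) (f : C(X, ℝ)) (c : ℝ) :
    (∃ x, f x = c) ↔ ∃ y, Φ f y = c * Φ 1 y := by
  have h := not_congr (hnv (f - c • 1))
  rw [hlin.map_sub, hlin.map_smul] at h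
  simpa [sub_eq_zero] using h

/-- A linear map preserving non-vanishing in both directions, with `Φ 1` strictly positive,
preserves and reflects positivity. -/
theorem map_nonneg_iff_of_nonvanishing {X Y : Type*} [TopologicalSpace X] [TopologicalSpace Y]
    (Φ : C(X, ℝ) → C(Y, ℝ)) (hlin : IsLinearMap ℝ Φ)
    (hnv : ∀ f : C(X, ℝ), (∀ x, f x ≠ 0) ↔ (∀ y, Φ f y ≠ 0))
    (hpos : ∀ y : Y, 0 < Φ 1 y) (f : C(X, ℝ)) : 0 ≤ Φ f ↔ 0 ≤ f := by
  simp only [ContinuousMap.le_def, ContinuousMap.zero_apply]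
  constructor
  · intro h x
    obtain ⟨y, hy⟩ := (exists_eq_iff_exists_map_eq_mul Φ hlin hnv f (f x)).1 ⟨x, rfl⟩
    exact nonneg_of_mul_nonneg_left (hy ▸ h y) (hpos y)
  · intro h y
    have hy : Φ f y = Φ f y / Φ 1 y * Φ 1 y := (div_mul_cancel₀ _ (hpos y).ne').symm
    obtain ⟨x, hx⟩ := (exists_eq_iff_exists_map_eq_mul Φ hlin hnv f _).2 ⟨y, hy⟩
    rw [hy, ← hx]
    exact mul_nonneg (h x) (hpos y).le

variable {X Y : Type*}
  [TopologicalSpace X] [CompactSpace X] [T2Space X]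
  [TopologicalSpace Y] [CompactSpace Y] [T2Space Y]

/-- If moreover Φ1 is strictly positive, then Φ is a Riesz isomorphism. -/
theorem stmt_16 [Nonempty X] [Nonempty Y] (Φ : C(X, ℝ) → C(Y, ℝ))
    (hlin : IsLinearMap ℝ Φ) (hsurj : Function.Surjective Φ)
    (hnv : ∀ f : C(X, ℝ), (∀ x, f x ≠ 0) ↔ (∀ y, Φ f y ≠ 0))
    (hpos : ∀ y : Y, 0 < Φ 1 y) :
    Function.Bijective Φ ∧ ∀ f g : C(X, ℝ), Φ (f ⊔ g) = Φ f ⊔ Φ g := by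
  have hle (f g : C(X, ℝ)) : Φ f ≤ Φ g ↔ f ≤ g := by
    have h := map_nonneg_iff_of_nonvanishing Φ hlin hnv hpos (g - f)
    rw [hlin.map_sub] at h
    simpa only [ContinuousMap.le_def, ContinuousMap.zero_apply, ContinuousMap.sub_apply,
      sub_nonneg] using h
  let Ψ : C(X, ℝ) ↪o C(Y, ℝ) := OrderEmbedding.ofMapLEIff Φ hle
  exact ⟨⟨Ψ.injective, hsurj⟩, map_sup (RelIso.ofSurjective Ψ hsurj : C(X, ℝ) ≃o C(Y, ℝ))⟩
end

section
/- Let Y₀ = [0,1/2] ∪ [1,3/2] ⊆ ℝ and define Φ : C([0,1]) → C(Y₀) by (Φf)(y) = f(2y) for 0 ≤ y ≤ 1/2 and (Φf)(y) = (2y−2)f(0) + (3−2y)f(1) for 1 ≤ y ≤ 3/2. Then Φ is a well-defined linear isometry that is not surjective, Φf is non-vanishing on Y₀ if and only if f is non-vanishing on [0,1], and [0,1] is not homeomorphic to Y₀. -/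
open Function Set

/-- Y₀ = [0,1/2] ∪ [1,3/2] is a compact space. -/
instance : CompactSpace ↥(Set.Icc (0:ℝ) (1/2) ∪ Set.Icc (1:ℝ) (3/2)) :=
  isCompact_iff_compactSpace.mp (isCompact_Icc.union isCompact_Icc)

/-- The operator `f ↦ Φ f`, written by a single formula: the projection of `2 * y` to `[0,1]` is
`1` on `[1,3/2]`, and the second summand vanishes on `[0,1/2]`. -/
noncomputable def stretchExtend (f : C(↥(Set.Icc (0:ℝ) 1), ℝ)) :
    C(↥(Set.Icc (0:ℝ) (1/2) ∪ Set.Icc (1:ℝ) (3/2)), ℝ) where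
  toFun y := f (Set.projIcc 0 1 zero_le_one (2 * (y : ℝ))) +
    max (2 * (y : ℝ) - 2) 0 * (f ⟨0, by simp⟩ - f ⟨1, by simp⟩)
  continuous_toFun := by
    have h : Continuous (Set.projIcc (0:ℝ) 1 zero_le_one) := continuous_projIcc
    fun_prop

lemma stretchExtend_apply_left (f : C(↥(Set.Icc (0:ℝ) 1), ℝ))
    (y : ↥(Set.Icc (0:ℝ) (1/2) ∪ Set.Icc (1:ℝ) (3/2))) (hy : (y : ℝ) ∈ Set.Icc (0:ℝ) (1/2))
    (h : 2 * (y : ℝ) ∈ Set.Icc (0:ℝ) 1) :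
    stretchExtend f y = f ⟨2 * (y : ℝ), h⟩ := by
  have hm : max (2 * (y : ℝ) - 2) 0 = 0 := max_eq_right (by linarith [hy.2])
  simp [stretchExtend, hm, Set.projIcc_of_mem zero_le_one h]

lemma stretchExtend_apply_right (f : C(↥(Set.Icc (0:ℝ) 1), ℝ))
    (y : ↥(Set.Icc (0:ℝ) (1/2) ∪ Set.Icc (1:ℝ) (3/2))) (hy : (y : ℝ) ∈ Set.Icc (1:ℝ) (3/2)) :
    stretchExtend f y =
      (2 * (y : ℝ) - 2) * f ⟨0, by simp⟩ + (3 - 2 * (y : ℝ)) * f ⟨1, by simp⟩ := by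
  have hm : max (2 * (y : ℝ) - 2) 0 = 2 * (y : ℝ) - 2 := max_eq_left (by linarith [hy.1])
  have hp : Set.projIcc (0:ℝ) 1 zero_le_one (2 * (y : ℝ)) = ⟨1, by simp⟩ :=
    Set.projIcc_of_right_le zero_le_one (by linarith [hy.1])
  simp only [stretchExtend, ContinuousMap.coe_mk, hm, hp]
  ring

lemma exists_stretchExtend_eq (f : C(↥(Set.Icc (0:ℝ) 1), ℝ)) (x : ↥(Set.Icc (0:ℝ) 1)) :
    ∃ y, stretchExtend f y = f x := by
  have hx : (x : ℝ) / 2 ∈ Set.Icc (0:ℝ) (1/2) :=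
    ⟨by linarith [x.2.1], by linarith [x.2.2]⟩
  have h : 2 * ((x : ℝ) / 2) = x := by ring
  refine ⟨⟨(x : ℝ) / 2, Or.inl hx⟩, ?_⟩
  rw [stretchExtend_apply_left f _ hx (by rw [h]; exact x.2)]
  exact congrArg f (Subtype.ext h)

/-- Each value of `stretchExtend f` is either a value of `f` or a convex combination of `f 0` and
`f 1`, hence a value of `f` by the intermediate value theorem. -/
lemma exists_eq_stretchExtend (f : C(↥(Set.Icc (0:ℝ) 1), ℝ))
    (y : ↥(Set.Icc (0:ℝ) (1/2) ∪ Set.Icc (1:ℝ) (3/2))) :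
    ∃ x, f x = stretchExtend f y := by
  rcases y.2 with hy | hy
  · exact ⟨_, (stretchExtend_apply_left f y hy
      ⟨by linarith [hy.1], by linarith [hy.2]⟩).symm⟩
  · have hconv : Convex ℝ (Set.range f) :=
      (isPreconnected_range f.continuous).ordConnected.convex
    have h := hconv (Set.mem_range_self ⟨0, by simp⟩) (Set.mem_range_self ⟨1, by simp⟩)
      (a := 2 * (y : ℝ) - 2) (b := 3 - 2 * (y : ℝ)) (by linarith [hy.1]) (by linarith [hy.2])
      (by ring)
    rw [stretchExtend_apply_right f y hy]
    exact h

lemma range_stretchExtend (f : C(↥(Set.Icc (0:ℝ) 1), ℝ)) :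
    Set.range (stretchExtend f) = Set.range f := by
  refine Set.Subset.antisymm ?_ ?_
  · rintro _ ⟨y, rfl⟩
    exact exists_eq_stretchExtend f y
  · rintro _ ⟨x, rfl⟩
    exact exists_stretchExtend_eq f x

lemma isLinearMap_stretchExtend : IsLinearMap ℝ stretchExtend where
  map_add f g := by
    ext y
    simp only [stretchExtend, ContinuousMap.coe_mk, ContinuousMap.add_apply]
    ring
  map_smul c f := by
    ext y
    simp only [stretchExtend, ContinuousMap.coe_mk, ContinuousMap.smul_apply, smul_eq_mul]
    ring

lemma norm_stretchExtend (f : C(↥(Set.Icc (0:ℝ) 1), ℝ)) : ‖stretchExtend f‖ = ‖f‖ := by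
  refine le_antisymm ((ContinuousMap.norm_le _ (norm_nonneg _)).2 fun y => ?_)
    ((ContinuousMap.norm_le _ (norm_nonneg _)).2 fun x => ?_)
  · obtain ⟨x, hx⟩ := exists_eq_stretchExtend f y
    exact hx ▸ f.norm_coe_le_norm x
  · obtain ⟨y, hy⟩ := exists_stretchExtend_eq f x
    exact hy ▸ (stretchExtend f).norm_coe_le_norm y

lemma not_surjective_stretchExtend : ¬ Function.Surjective stretchExtend := by
  intro hs
  obtain ⟨f, hf⟩ := hs ⟨fun y => (y : ℝ), continuous_subtype_val⟩
  have h₁ := stretchExtend_apply_left f ⟨1/2, Or.inl (by norm_num)⟩ (by norm_num) (by norm_num)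
  have h₂ := stretchExtend_apply_right f ⟨1, Or.inr (by norm_num)⟩ (by norm_num)
  rw [hf] at h₁ h₂
  norm_num at h₁ h₂
  linarith

lemma not_preconnectedSpace_union_Icc :
    ¬ PreconnectedSpace ↥(Set.Icc (0:ℝ) (1/2) ∪ Set.Icc (1:ℝ) (3/2)) := by
  intro h
  have hc := (isPreconnected_iff_preconnectedSpace.2 h).ordConnected
  have hm : (3/4 : ℝ) ∈ Set.Icc (0:ℝ) (1/2) ∪ Set.Icc (1:ℝ) (3/2) :=
    hc.out (x := 0) (Or.inl (by norm_num)) (y := 1) (Or.inr (by norm_num)) (by norm_num)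
  norm_num at hm

/-- The map Φ : C([0,1]) → C([0,1/2] ∪ [1,3/2]) given by (Φf)(y) = f(2y) for
0 ≤ y ≤ 1/2 and (Φf)(y) = (2y-2)f(0) + (3-2y)f(1) for 1 ≤ y ≤ 3/2 is a
well-defined, non-surjective linear isometry preserving non-vanishing in both
directions, yet [0,1] is not homeomorphic to [0,1/2] ∪ [1,3/2]. -/
theorem stmt_17 :
    ∃ Φ : C(↥(Set.Icc (0:ℝ) 1), ℝ) →
        C(↥(Set.Icc (0:ℝ) (1/2) ∪ Set.Icc (1:ℝ) (3/2)), ℝ),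
      (∀ (f : C(↥(Set.Icc (0:ℝ) 1), ℝ))
          (y : ↥(Set.Icc (0:ℝ) (1/2) ∪ Set.Icc (1:ℝ) (3/2)))
          (hy : (y : ℝ) ∈ Set.Icc (0:ℝ) (1/2)),
        Φ f y = f ⟨2 * (y : ℝ), by
          simp only [Set.mem_Icc] at hy ⊢; constructor <;> linarith [hy.1, hy.2]⟩) ∧
      (∀ (f : C(↥(Set.Icc (0:ℝ) 1), ℝ))
          (y : ↥(Set.Icc (0:ℝ) (1/2) ∪ Set.Icc (1:ℝ) (3/2)))
          (hy : (y : ℝ) ∈ Set.Icc (1:ℝ) (3/2)),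
        Φ f y = (2 * (y : ℝ) - 2) * f ⟨0, by simp only [Set.mem_Icc]; norm_num⟩
          + (3 - 2 * (y : ℝ)) * f ⟨1, by simp only [Set.mem_Icc]; norm_num⟩) ∧
      IsLinearMap ℝ Φ ∧
      (∀ f : C(↥(Set.Icc (0:ℝ) 1), ℝ), ‖Φ f‖ = ‖f‖) ∧
      ¬ Function.Surjective Φ ∧
      (∀ f : C(↥(Set.Icc (0:ℝ) 1), ℝ),
        (∀ x, f x ≠ 0) ↔ (∀ y, Φ f y ≠ 0)) ∧
      ¬ Nonempty
        (↥(Set.Icc (0:ℝ) 1) ≃ₜ ↥(Set.Icc (0:ℝ) (1/2) ∪ Set.Icc (1:ℝ) (3/2))) := by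
  refine ⟨stretchExtend, fun f y hy => stretchExtend_apply_left f y hy _,
    stretchExtend_apply_right, isLinearMap_stretchExtend, norm_stretchExtend,
    not_surjective_stretchExtend, fun f => ?_, ?_⟩
  · rw [← Set.forall_mem_range (f := f) (p := fun r : ℝ => r ≠ 0), ← range_stretchExtend f,
      Set.forall_mem_range]
  · rintro ⟨e⟩
    have : PreconnectedSpace ↥(Set.Icc (0:ℝ) 1) :=
      isPreconnected_iff_preconnectedSpace.1 isPreconnected_Icc
    exact not_preconnectedSpace_union_Icc
      ⟨e.surjective.range_eq ▸ isPreconnected_range e.continuous⟩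
end
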